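/- Let X = [X_{i,j}]_{i,j≥1} be an infinite separately exchangeable binary random array. Then there exists a probability distribution π on the space of measurable functions W : [0,1]² → [0,1] (graphons) such that P(X ∈ ·) = ∫ P_W(·) dπ(W), where P_W is the probability law of the binary array generated as follows: with (U_i)_{i≥1}, (V_j)_{j≥1}, (U_{i,j})_{i,j≥1} independent i.i.d. Uniform(0,1) random variables, set X_{i,j} = 1 if U_{i,j} ≤ W(U_i, V_j) and X_{i,j} = 0 otherwise. -/

import Mathlib

open MeasureTheory ProbabilityTheory Filter Topology
open scoped ENNReal NNReal

/-- An infinite random array `[X_{i,j}]` is separately exchangeable if its joint law is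
invariant under finite permutations acting separately on rows and columns. -/
def SeparatelyExchangeable {Ω 𝕏 : Type*} [MeasurableSpace Ω] [MeasurableSpace 𝕏]
    (μ : Measure Ω) (X : ℕ → ℕ → Ω → 𝕏) : Prop :=
  ∀ σ τ : Equiv.Perm ℕ, {n | σ n ≠ n}.Finite → {n | τ n ≠ n}.Finite →
    Measure.map (fun ω (p : ℕ × ℕ) => X (σ p.1) (τ p.2) ω) μ
      = Measure.map (fun ω (p : ℕ × ℕ) => X p.1 p.2 ω) μ

/-- The Uniform(0,1) distribution on `ℝ`. -/
noncomputable def unif : Measure ℝ := volume.restrict (Set.Icc 0 1)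

instance : IsProbabilityMeasure unif := by
  constructor
  rw [unif, Measure.restrict_apply MeasurableSet.univ, Set.univ_inter, Real.volume_Icc]
  norm_num

open Function in
/-- Any injection of `ℕ` agrees on a finite set with a finitely supported permutation. -/
lemma exists_finite_perm_eqOn {φ : ℕ → ℕ} (hφ : Injective φ) (s : Finset ℕ) :
    ∃ σ : Equiv.Perm ℕ, {n | σ n ≠ n}.Finite ∧ ∀ k ∈ s, σ k = φ k := by
  classical
  obtain ⟨N, hN⟩ : ∃ N, ∀ k ∈ s, k < N ∧ φ k < N := by
    refine ⟨(s ∪ s.image φ).sup id + 1, fun k hk => ⟨?_, ?_⟩⟩ <;>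
    · refine Nat.lt_succ_of_le (Finset.le_sup (f := id) ?_)
      simp only [Finset.mem_union, Finset.mem_image]
      grind
  let p : {n // n < N} → Prop := fun a => a.1 ∈ s
  let f : {a // p a} → {n // n < N} := fun a => ⟨φ a.1.1, (hN _ a.2).2⟩
  have hf : Injective f := fun a b h =>
    Subtype.ext (Subtype.ext (hφ (congrArg Subtype.val h)))
  have : Finite {n // n < N} := inferInstanceAs (Finite (Set.Iio N))
  let e : {a // p a} ≃ {a // a ∈ Set.range f} := Equiv.ofInjective f hf
  refine ⟨Equiv.Perm.ofSubtype e.extendSubtype, ?_, fun k hk => ?_⟩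
  · refine (Set.finite_Iio N).subset fun n hn => ?_
    by_contra h
    exact hn (Equiv.Perm.ofSubtype_apply_of_not_mem _ h)
  · rw [Equiv.Perm.ofSubtype_apply_of_mem (p := fun n => n < N) _ (hN k hk).1,
      Equiv.extendSubtype_apply_of_mem e _ (show p ⟨k, (hN k hk).1⟩ from hk)]
    rfl

/-- Relabelling of the rows and columns of an array. -/
def reindex {𝕏 : Type*} (φ ψ : ℕ → ℕ) (x : ℕ × ℕ → 𝕏) : ℕ × ℕ → 𝕏 :=
  fun p => x (φ p.1, ψ p.2)

lemma measurable_reindex {𝕏 : Type*} [MeasurableSpace 𝕏] (φ ψ : ℕ → ℕ) :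
    Measurable (reindex (𝕏 := 𝕏) φ ψ) := by
  unfold reindex; fun_prop

/-- The law of a separately exchangeable array is invariant under injective relabellings. -/
lemma SeparatelyExchangeable.measurePreserving_reindex {Ω 𝕏 : Type*} [MeasurableSpace Ω]
    [MeasurableSpace 𝕏] {μ : Measure Ω} [IsProbabilityMeasure μ] {X : ℕ → ℕ → Ω → 𝕏}
    (hX : ∀ i j, Measurable (X i j)) (hse : SeparatelyExchangeable μ X) {φ ψ : ℕ → ℕ}
    (hφ : Function.Injective φ) (hψ : Function.Injective ψ) :
    MeasurePreserving (reindex φ ψ) (μ.map fun ω (p : ℕ × ℕ) => X p.1 p.2 ω)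
      (μ.map fun ω (p : ℕ × ℕ) => X p.1 p.2 ω) := by
  have hm : Measurable fun ω (p : ℕ × ℕ) => X p.1 p.2 ω := by fun_prop
  have hr := measurable_reindex (𝕏 := 𝕏) φ ψ
  have := Measure.isProbabilityMeasure_map (μ := μ) hm.aemeasurable
  set P := μ.map fun ω (p : ℕ × ℕ) => X p.1 p.2 ω with hP
  refine ⟨hr, ?_⟩
  have := Measure.isProbabilityMeasure_map (μ := P) hr.aemeasurable
  refine IsProjectiveLimit.unique (P := fun I => P.map I.restrict) (fun I => ?_) fun I => rfl
  obtain ⟨σ, hσ, hσφ⟩ := exists_finite_perm_eqOn hφ (I.image Prod.fst)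
  obtain ⟨τ, hτ, hτψ⟩ := exists_finite_perm_eqOn hψ (I.image Prod.snd)
  have h := hse σ τ hσ hτ
  rw [← hP] at h
  change _ = P.map I.restrict
  rw [Measure.map_map (Finset.measurable_restrict I) hr]
  conv_rhs => rw [← h]
  rw [hP,
    Measure.map_map ((Finset.measurable_restrict I).comp hr) hm,
    Measure.map_map (Finset.measurable_restrict I) (by fun_prop)]
  congr 1
  ext ω p
  have h1 := hσφ p.1.1 (Finset.mem_image_of_mem _ p.2)
  have h2 := hτψ p.1.2 (Finset.mem_image_of_mem _ p.2)
  simp [reindex, h1, h2]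

/-- If `f` is invariant under a measure-preserving map `T` that pulls `m` back into a smaller
σ-algebra `m₀`, then conditioning `f` on `m` is the same as conditioning on `m₀`. -/
lemma condExp_ae_eq_of_measurePreserving {S : Type*} {m₀ m mS : MeasurableSpace S}
    {P : Measure S} [IsProbabilityMeasure P] (hm₀ : m₀ ≤ m) (hm : m ≤ mS) {T : S → S}
    (hT : MeasurePreserving T P P) (hTm : m.comap T ≤ m₀) {f : S → ℝ} (hf : Measurable f)
    {c : ℝ} (hfc : ∀ x, |f x| ≤ c) (hfT : ∀ x, f (T x) = f x) :
    P[f | m] =ᵐ[P] P[f | m₀] := by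
  have hfi : Integrable f P := .of_bound hf.aestronglyMeasurable c (ae_of_all _ hfc)
  set g := P[f | m] with hg
  have hgm : StronglyMeasurable[m] g := stronglyMeasurable_condExp
  have hgi : Integrable g P := integrable_condExp
  have hgb : ∀ᵐ x ∂P, |g x| ≤ c := ae_bdd_abs_condExp_of_ae_bdd_abs (ae_of_all _ hfc)
  have hTm' : Measurable[m₀, m] T := measurable_iff_comap_le.2 hTm
  have hhm₀ : StronglyMeasurable[m₀] (g ∘ T) := hgm.comp_measurable hTm'
  have hhm : StronglyMeasurable[m] (g ∘ T) := hhm₀.mono hm₀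
  have hhb : ∀ᵐ x ∂P, |(g ∘ T) x| ≤ c := hT.quasiMeasurePreserving.ae hgb
  have hhi : Integrable (g ∘ T) P := hT.integrable_comp_of_integrable hgi
  have hgs : AEStronglyMeasurable g P := (hgm.mono hm).aestronglyMeasurable
  have hhs : AEStronglyMeasurable (g ∘ T) P := (hhm.mono hm).aestronglyMeasurable
  have i1 : Integrable (g * g) P := hgi.mul_bdd hgs hgb
  have i2 : Integrable ((g ∘ T) * (g ∘ T)) P := hhi.mul_bdd hhs hhb
  have i3 : Integrable ((g ∘ T) * g) P := hhi.mul_bdd hgs hgb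
  have pull : ∀ k : S → ℝ, StronglyMeasurable[m] k → (∀ᵐ x ∂P, |k x| ≤ c) →
      ∫ x, (k * f) x ∂P = ∫ x, (k * g) x ∂P := by
    intro k hk hkb
    rw [← integral_condExp hm]
    exact integral_congr_ae (condExp_stronglyMeasurable_mul_of_bound hm hk hfi c hkb)
  have e1 : ∫ x, ((g ∘ T) * (g ∘ T)) x ∂P = ∫ x, (g * g) x ∂P := by
    have := integral_map hT.aemeasurable (f := g * g) (by rw [hT.map_eq]; exact hgs.mul hgs)
    rw [hT.map_eq] at this
    exact this.symm
  have e2 : ∫ x, ((g ∘ T) * g) x ∂P = ∫ x, (g * g) x ∂P := by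
    rw [← pull _ hhm hhb, ← pull _ hgm hgb]
    have := integral_map hT.aemeasurable (f := g * f)
      (by rw [hT.map_eq]; exact hgs.mul hf.aestronglyMeasurable)
    rw [hT.map_eq] at this
    rw [this]
    simp [hfT]
  have e3 : ∫ x, (g x - g (T x)) ^ 2 ∂P = 0 := by
    have : (fun x => (g x - g (T x)) ^ 2)
        = fun x => ((g * g) x - 2 * ((g ∘ T) * g) x) + ((g ∘ T) * (g ∘ T)) x := by
      ext x; simp; ring
    have h2 : Integrable (fun x => (g * g) x - 2 * ((g ∘ T) * g) x) P := i1.sub (i3.const_mul 2)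
    rw [this, integral_add h2 i2, integral_sub i1 (i3.const_mul 2),
      integral_const_mul, e1, e2]
    ring
  have e4 : g =ᵐ[P] g ∘ T := by
    have hi : Integrable (fun x => (g x - g (T x)) ^ 2) P := by
      refine ((i1.sub (i3.const_mul 2)).add i2).congr (ae_of_all _ fun x => ?_)
      simp; ring
    filter_upwards [(integral_eq_zero_iff_of_nonneg (fun x => sq_nonneg _) hi).1 e3] with x hx
    simpa [sub_eq_zero] using hx
  calc g =ᵐ[P] g ∘ T := e4
    _ = P[g ∘ T | m₀] := (condExp_of_stronglyMeasurable (hm₀.trans hm) hhm₀ hhi).symm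
    _ =ᵐ[P] P[g | m₀] := condExp_congr_ae e4.symm
    _ =ᵐ[P] P[f | m₀] := condExp_condExp_of_le hm₀ hm

/-- If a measure-preserving map `T` fixes `Y` and pulls `m` back into `σ(Z)` with `Z` being
`m`-measurable, then the conditional distribution of `Y` given `Z` also describes `Y` given `m`. -/
lemma setLIntegral_condDistrib_of_measurePreserving {S β γ : Type*} {m mS : MeasurableSpace S}
    [MeasurableSpace β] [MeasurableSpace γ] [StandardBorelSpace γ] [Nonempty γ]
    {P : Measure S} [IsProbabilityMeasure P] (hm : m ≤ mS) {T : S → S}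
    (hT : MeasurePreserving T P P) {Z : S → β} {Y : S → γ} (hY : Measurable Y)
    (hZ : Measurable[m] Z) (hTm : Measurable[.comap Z ‹_›, m] T)
    (hYT : ∀ x, Y (T x) = Y x) {D : Set γ} (hD : MeasurableSet D) {B : Set S}
    (hB : MeasurableSet[m] B) :
    ∫⁻ x in B, condDistrib Y Z P (Z x) D ∂P = ∫⁻ x in B, (Y ⁻¹' D).indicator 1 x ∂P := by
  have hZS : Measurable Z := hZ.mono hm le_rfl
  have h := condExp_ae_eq_of_measurePreserving hZ.comap_le hm hT hTm.comap_le
    (f := (Y ⁻¹' D).indicator fun _ => 1) (measurable_const.indicator (hY hD)) (c := 1)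
    (fun x => by by_cases hx : x ∈ Y ⁻¹' D <;> simp [hx])
    (fun x => by by_cases hx : Y x ∈ D <;> simp [Set.indicator, hYT, hx])
  have h2 := (condDistrib_ae_eq_condExp (μ := P) hZS hY hD).trans h.symm
  have hfi : Integrable ((Y ⁻¹' D).indicator fun _ => (1 : ℝ)) P :=
    (integrable_const _).indicator (hY hD)
  have h3 : ∫ x in B, (condDistrib Y Z P (Z x)).real D ∂P
      = ∫ x in B, (Y ⁻¹' D).indicator (fun _ => (1 : ℝ)) x ∂P := by
    rw [← setIntegral_condExp hm hfi hB]
    exact integral_congr_ae (ae_restrict_of_ae h2)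
  have hi := integrable_toReal_condDistrib (Y := Y) (μ := P) hZS.aemeasurable hD
  have h4 := congrArg ENNReal.ofReal h3
  rw [ofReal_integral_eq_lintegral_ofReal hi.integrableOn (ae_of_all _ fun _ => measureReal_nonneg),
    ofReal_integral_eq_lintegral_ofReal hfi.integrableOn
      (ae_of_all _ fun _ => Set.indicator_nonneg (fun _ _ => zero_le_one) _)] at h4
  convert h4 using 3 with x x
  · simp
  · by_cases hx : x ∈ Y ⁻¹' D <;> simp [hx]

/-- Functions with the same integrals over `m`-measurable sets have the same integrals against
`m`-measurable functions. -/
lemma lintegral_mul_congr_of_setLIntegral_eq {S : Type*} {m mS : MeasurableSpace S}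
    {P : Measure S} (hm : m ≤ mS) {f g : S → ℝ≥0∞} (hf : Measurable f) (hg : Measurable g)
    (hfg : ∀ B, MeasurableSet[m] B → ∫⁻ x in B, f x ∂P = ∫⁻ x in B, g x ∂P)
    {H : S → ℝ≥0∞} (hH : Measurable[m] H) :
    ∫⁻ x, f x * H x ∂P = ∫⁻ x, g x * H x ∂P := by
  have h : (P.withDensity f).trim hm = (P.withDensity g).trim hm := by
    refine @Measure.ext _ m _ _ fun B hB => ?_
    rw [trim_measurableSet_eq hm hB, trim_measurableSet_eq hm hB, withDensity_apply _ (hm _ hB),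
      withDensity_apply _ (hm _ hB), hfg B hB]
  have hH' := hH.mono hm le_rfl
  have h1 := lintegral_withDensity_eq_lintegral_mul P hf hH'
  have h2 := lintegral_withDensity_eq_lintegral_mul P hg hH'
  simp only [Pi.mul_apply] at h1 h2
  rw [← h1, ← h2, ← lintegral_trim hm hH, ← lintegral_trim hm hH, h]

/-- Factors of a product can be replaced one at a time by factors with the same integrals against
all functions measurable with respect to the information carried by the other factors. -/
lemma lintegral_prod_mul_congr {S ι : Type*} [Fintype ι] {mS : MeasurableSpace S}
    {P : Measure S} (m : ι → MeasurableSpace S) {f g : ι → S → ℝ≥0∞}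
    (hfm : ∀ i j, i ≠ j → Measurable[m i] (f j)) (hgm : ∀ i j, i ≠ j → Measurable[m i] (g j))
    (hfg : ∀ i H, Measurable[m i] H → ∫⁻ x, f i x * H x ∂P = ∫⁻ x, g i x * H x ∂P)
    {H : S → ℝ≥0∞} (hH : ∀ i, Measurable[m i] H) :
    ∫⁻ x, (∏ i, f i x) * H x ∂P = ∫⁻ x, (∏ i, g i x) * H x ∂P := by
  classical
  suffices h : ∀ s : Finset ι, ∫⁻ x, (∏ i, f i x) * H x ∂P
      = ∫⁻ x, (∏ i, if i ∈ s then g i x else f i x) * H x ∂P by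
    simpa using h Finset.univ
  intro s
  induction s using Finset.induction_on with
  | empty => simp
  | insert a s ha ih =>
    rw [ih]
    let R : S → ℝ≥0∞ := fun x =>
      (∏ i ∈ Finset.univ.erase a, if i ∈ s then g i x else f i x) * H x
    have hR : Measurable[m a] R := by
      refine Measurable.mul (Finset.measurable_prod _ fun i hi => ?_) (hH a)
      have hia : a ≠ i := (Finset.ne_of_mem_erase hi).symm
      by_cases his : i ∈ s
      · simpa [his] using hgm a i hia
      · simpa [his] using hfm a i hia
    have key := hfg a R hR
    convert key using 3 with x x
    · rw [← Finset.mul_prod_erase _ _ (Finset.mem_univ a), mul_assoc]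
      simp [ha, R]
    · rw [← Finset.mul_prod_erase _ _ (Finset.mem_univ a), mul_assoc]
      simp only [Finset.mem_insert, true_or, if_true, R]
      congr 2
      refine Finset.prod_congr rfl fun i hi => ?_
      simp [Finset.ne_of_mem_erase hi]

lemma isCountablySpanning_of_univ_mem {δ : Type*} {C : Set (Set δ)} (hC : Set.univ ∈ C) :
    IsCountablySpanning C :=
  ⟨fun _ => Set.univ, fun _ => hC, Set.iUnion_const _⟩

/-- Probability measures on `α × (ι → β) × (κ → γ)` are determined by measurable boxes. -/
lemma measure_ext_prod_pi {α β γ ι κ : Type*} [Finite ι] [Finite κ]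
    [MeasurableSpace α] [MeasurableSpace β] [MeasurableSpace γ]
    {μ ν : Measure (α × (ι → β) × (κ → γ))} [IsProbabilityMeasure μ] [IsProbabilityMeasure ν]
    (h : ∀ (A : Set α) (B : ι → Set β) (C : κ → Set γ), MeasurableSet A →
      (∀ i, MeasurableSet (B i)) → (∀ j, MeasurableSet (C j)) →
      μ (A ×ˢ Set.univ.pi B ×ˢ Set.univ.pi C) = ν (A ×ˢ Set.univ.pi B ×ˢ Set.univ.pi C)) :
    μ = ν := by
  cases nonempty_fintype ι
  cases nonempty_fintype κ
  let Cα : Set (Set α) := {s | MeasurableSet s}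
  let Cβ : Set (Set (ι → β)) := Set.univ.pi '' Set.univ.pi fun _ => {s | MeasurableSet s}
  let Cγ : Set (Set (κ → γ)) := Set.univ.pi '' Set.univ.pi fun _ => {s | MeasurableSet s}
  have uβ : Set.univ ∈ Cβ := ⟨fun _ => Set.univ, by simp, by simp⟩
  have uγ : Set.univ ∈ Cγ := ⟨fun _ => Set.univ, by simp, by simp⟩
  have uβγ : Set.univ ∈ Set.image2 (· ×ˢ ·) Cβ Cγ := ⟨_, uβ, _, uγ, by simp⟩
  have hgen := generateFrom_eq_prod (C := Cα) (D := Set.image2 (· ×ˢ ·) Cβ Cγ)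
    MeasurableSpace.generateFrom_measurableSet
    (generateFrom_eq_prod generateFrom_pi generateFrom_pi (isCountablySpanning_of_univ_mem uβ)
      (isCountablySpanning_of_univ_mem uγ))
    (isCountablySpanning_of_univ_mem (C := Cα) MeasurableSet.univ)
    (isCountablySpanning_of_univ_mem uβγ)
  refine ext_of_generate_finite _ hgen.symm
    (MeasurableSpace.isPiSystem_measurableSet.prod (isPiSystem_pi.prod isPiSystem_pi)) ?_ (by simp)
  rintro _ ⟨A, hA, _, ⟨_, ⟨B, hB, rfl⟩, _, ⟨C, hC, rfl⟩, rfl⟩, rfl⟩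
  exact h A B C hA (fun i => hB i trivial) fun j => hC j trivial

/-- A Markov kernel into a standard Borel space is the image of `unif` under a measurable map. -/
lemma exists_measurable_map_unif_eq {α β : Type*} [MeasurableSpace α] [MeasurableSpace β]
    [StandardBorelSpace β] [Nonempty β] (κ : Kernel α β) [IsMarkovKernel κ] :
    ∃ f : α → ℝ → β, Measurable (Function.uncurry f) ∧ ∀ a, unif.map (f a) = κ a := by
  obtain ⟨f, hf, hκ⟩ := κ.exists_measurable_map_eq_unitInterval
  have hp : Measurable (Set.projIcc (0 : ℝ) 1 zero_le_one) := continuous_projIcc.measurable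
  have hpu : unif.map (Set.projIcc (0 : ℝ) 1 zero_le_one) = volume := by
    have : unif = (volume : Measure unitInterval).map Subtype.val := by
      rw [unif, ← map_comap_subtype_coe measurableSet_Icc]; rfl
    rw [this, Measure.map_map hp measurable_subtype_coe]
    convert Measure.map_id
    ext x; simp
  refine ⟨fun a u => f a (Set.projIcc 0 1 zero_le_one u),
    hf.comp (measurable_fst.prodMk (hp.comp measurable_snd)), fun a => ?_⟩
  rw [← hκ a, ← hpu, Measure.map_map (hf.of_uncurry_left) hp]
  rfl

lemma condDistrib_comp_measurePreserving {S β γ : Type*} [MeasurableSpace S]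
    [MeasurableSpace β] [MeasurableSpace γ] [StandardBorelSpace γ] [Nonempty γ]
    {P : Measure S} [IsProbabilityMeasure P] {T : S → S} (hT : MeasurePreserving T P P)
    {Z : S → β} {Y : S → γ} (hZ : Measurable Z) (hY : Measurable Y) :
    condDistrib (Y ∘ T) (Z ∘ T) P = condDistrib Y Z P := by
  have h : P.map (fun x => ((Z ∘ T) x, (Y ∘ T) x)) = P.map fun x => (Z x, Y x) := by
    conv_rhs => rw [← hT.map_eq, Measure.map_map (hZ.prodMk hY) hT.measurable]
    rfl
  rw [condDistrib, condDistrib]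
  congr 1

lemma measurable_indicator_one_preimage {S γ : Type*} {m : MeasurableSpace S} [MeasurableSpace γ]
    {Y : S → γ} (hY : Measurable Y) {D : Set γ} (hD : MeasurableSet D) :
    Measurable ((Y ⁻¹' D).indicator 1 : S → ℝ≥0∞) :=
  measurable_one.indicator (hY hD)

lemma measurable_eval_prod_pi {α β γ β' γ' ι κ : Type*} [MeasurableSpace α] [MeasurableSpace β]
    [MeasurableSpace γ] [MeasurableSpace β'] [MeasurableSpace γ'] {F : α → β → β'} {G : α → γ → γ'}
    (hF : Measurable (Function.uncurry F)) (hG : Measurable (Function.uncurry G)) :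
    Measurable fun q : α × (ι → β) × (κ → γ) =>
      (q.1, (fun i => F q.1 (q.2.1 i)), fun j => G q.1 (q.2.2 j)) := by
  have hF' : ∀ i : ι, Measurable fun q : α × (ι → β) × (κ → γ) => F q.1 (q.2.1 i) := fun i =>
    hF.comp (by fun_prop : Measurable fun q : α × (ι → β) × (κ → γ) => (q.1, q.2.1 i))
  have hG' : ∀ j : κ, Measurable fun q : α × (ι → β) × (κ → γ) => G q.1 (q.2.2 j) := fun j =>
    hG.comp (by fun_prop : Measurable fun q : α × (ι → β) × (κ → γ) => (q.1, q.2.2 j))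
  fun_prop

section Array

/-- The part of an array carried by even rows and even columns. -/
def corner (x : ℕ × ℕ → Bool) : ℕ × ℕ → Bool := fun p => x (2 * p.1, 2 * p.2)

/-- The trace of the `i`-th odd row on the columns divisible by four. -/
def rowTrace (i : ℕ) (x : ℕ × ℕ → Bool) : ℕ → Bool := fun l => x (2 * i + 1, 4 * l)

/-- The trace of the `j`-th odd column on the rows divisible by four. -/
def colTrace (j : ℕ) (x : ℕ × ℕ → Bool) : ℕ → Bool := fun k => x (4 * k, 2 * j + 1)

/-- The information that determines the conditional law of an entry with odd indices. -/
def entryTrace (i j : ℕ) (x : ℕ × ℕ → Bool) : (ℕ × ℕ → Bool) × (ℕ → Bool) × (ℕ → Bool) :=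
  (corner x, rowTrace i x, colTrace j x)

/-- The entry in the `i`-th odd row and the `j`-th odd column. -/
def oddEntry (i j : ℕ) (x : ℕ × ℕ → Bool) : Bool := x (2 * i + 1, 2 * j + 1)

/-- The σ-algebra generated by the entries with indices in `s`. -/
abbrev entriesOn (s : Set (ℕ × ℕ)) : MeasurableSpace (ℕ × ℕ → Bool) :=
  .comap (fun x (p : s) => x p) inferInstance

lemma measurable_entriesOn_apply {s : Set (ℕ × ℕ)} {p : ℕ × ℕ} (hp : p ∈ s) :
    Measurable[entriesOn s] fun x : ℕ × ℕ → Bool => x p :=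
  (measurable_pi_apply (⟨p, hp⟩ : s)).comp
    (comap_measurable fun (x : ℕ × ℕ → Bool) (p : s) => x p)

lemma measurable_into_entriesOn {S : Type*} {m : MeasurableSpace S} {s : Set (ℕ × ℕ)}
    {T : S → ℕ × ℕ → Bool} (h : ∀ p ∈ s, Measurable[m] fun x => T x p) :
    Measurable[m, entriesOn s] T := by
  refine measurable_comap_iff.2 (measurable_pi_lambda _ fun p => h p p.2)

lemma entriesOn_le (s : Set (ℕ × ℕ)) : entriesOn s ≤ MeasurableSpace.pi :=
  (by fun_prop : Measurable fun (x : ℕ × ℕ → Bool) (p : s) => x p).comap_le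

lemma measurable_corner_entriesOn {s : Set (ℕ × ℕ)} (h : ∀ p : ℕ × ℕ, (2 * p.1, 2 * p.2) ∈ s) :
    Measurable[entriesOn s] corner :=
  @measurable_pi_lambda _ _ _ (entriesOn s) _ _ fun p => measurable_entriesOn_apply (h p)

lemma measurable_rowTrace_entriesOn {s : Set (ℕ × ℕ)} {i : ℕ} (h : ∀ l, (2 * i + 1, 4 * l) ∈ s) :
    Measurable[entriesOn s] (rowTrace i) :=
  @measurable_pi_lambda _ _ _ (entriesOn s) _ _ fun l => measurable_entriesOn_apply (h l)

lemma measurable_colTrace_entriesOn {s : Set (ℕ × ℕ)} {j : ℕ} (h : ∀ k, (4 * k, 2 * j + 1) ∈ s) :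
    Measurable[entriesOn s] (colTrace j) :=
  @measurable_pi_lambda _ _ _ (entriesOn s) _ _ fun k => measurable_entriesOn_apply (h k)

lemma measurable_entryTrace_entriesOn {s : Set (ℕ × ℕ)} {i j : ℕ}
    (h : ∀ k l, ¬ (k % 2 = 1 ∧ l % 2 = 1) → (k, l) ∈ s) :
    Measurable[entriesOn s] (entryTrace i j) := by
  have h1 : Measurable[entriesOn s] corner := measurable_corner_entriesOn fun p => h _ _ (by omega)
  have h2 : Measurable[entriesOn s] (rowTrace i) :=
    measurable_rowTrace_entriesOn fun p => h _ _ (by omega)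
  have h3 : Measurable[entriesOn s] (colTrace j) :=
    measurable_colTrace_entriesOn fun p => h _ _ (by omega)
  exact h1.prodMk (h2.prodMk h3)

@[fun_prop]
lemma measurable_corner : Measurable corner := by unfold corner; fun_prop

@[fun_prop]
lemma measurable_rowTrace (i : ℕ) : Measurable (rowTrace i) := by unfold rowTrace; fun_prop

@[fun_prop]
lemma measurable_colTrace (j : ℕ) : Measurable (colTrace j) := by unfold colTrace; fun_prop

@[fun_prop]
lemma measurable_entryTrace (i j : ℕ) : Measurable (entryTrace i j) := by
  unfold entryTrace; fun_prop

@[fun_prop]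
lemma measurable_oddEntry (i j : ℕ) : Measurable (oddEntry i j) := by
  unfold oddEntry; fun_prop

variable {P : Measure (ℕ × ℕ → Bool)} [IsProbabilityMeasure P]

lemma condDistrib_rowTrace
    (hP : ∀ φ ψ : ℕ → ℕ, φ.Injective → ψ.Injective → MeasurePreserving (reindex φ ψ) P P) (i : ℕ) :
    condDistrib (rowTrace i) corner P = condDistrib (rowTrace 0) corner P := by
  rw [← condDistrib_comp_measurePreserving
    (hP _ id (Equiv.swap (2 * i + 1) 1).injective Function.injective_id)
    measurable_corner (measurable_rowTrace 0)]
  congr 1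
  · ext x l
    simp [rowTrace, reindex]
  · ext x p
    simp only [corner, reindex, Function.comp, id]
    rw [Equiv.swap_apply_of_ne_of_ne] <;> omega

lemma condDistrib_colTrace
    (hP : ∀ φ ψ : ℕ → ℕ, φ.Injective → ψ.Injective → MeasurePreserving (reindex φ ψ) P P) (j : ℕ) :
    condDistrib (colTrace j) corner P = condDistrib (colTrace 0) corner P := by
  rw [← condDistrib_comp_measurePreserving
    (hP id _ Function.injective_id (Equiv.swap (2 * j + 1) 1).injective)
    measurable_corner (measurable_colTrace 0)]
  congr 1
  · ext x l
    simp [colTrace, reindex]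
  · ext x p
    simp only [corner, reindex, Function.comp, id]
    rw [Equiv.swap_apply_of_ne_of_ne] <;> omega

lemma condDistrib_oddEntry
    (hP : ∀ φ ψ : ℕ → ℕ, φ.Injective → ψ.Injective → MeasurePreserving (reindex φ ψ) P P)
    (i j : ℕ) :
    condDistrib (oddEntry i j) (entryTrace i j) P = condDistrib (oddEntry 0 0) (entryTrace 0 0) P := by
  rw [← condDistrib_comp_measurePreserving
    (hP _ _ (Equiv.swap (2 * i + 1) 1).injective (Equiv.swap (2 * j + 1) 1).injective)
    (measurable_entryTrace 0 0) (measurable_oddEntry 0 0)]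
  have hs : ∀ a k : ℕ, Equiv.swap (2 * a + 1) 1 (2 * k) = 2 * k := fun a k =>
    Equiv.swap_apply_of_ne_of_ne (by omega) (by omega)
  have hs' : ∀ a k : ℕ, Equiv.swap (2 * a + 1) 1 (4 * k) = 4 * k := fun a k =>
    Equiv.swap_apply_of_ne_of_ne (by omega) (by omega)
  congr 1
  · ext x
    simp [oddEntry, reindex]
  · ext x p <;>
    simp [entryTrace, corner, rowTrace, colTrace, reindex, hs, hs']

lemma lintegral_rowTrace_mul
    (hP : ∀ φ ψ : ℕ → ℕ, φ.Injective → ψ.Injective → MeasurePreserving (reindex φ ψ) P P)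
    (i : ℕ) {D : Set (ℕ → Bool)} (hD : MeasurableSet D) {H : (ℕ × ℕ → Bool) → ℝ≥0∞}
    (hH : Measurable[entriesOn {p | p.1 ≠ 2 * i + 1}] H) :
    ∫⁻ x, (rowTrace i ⁻¹' D).indicator 1 x * H x ∂P
      = ∫⁻ x, condDistrib (rowTrace 0) corner P (corner x) D * H x ∂P := by
  rw [← condDistrib_rowTrace hP i]
  symm
  refine lintegral_mul_congr_of_setLIntegral_eq (entriesOn_le _)
    ((Kernel.measurable_coe _ hD).comp measurable_corner)
    (measurable_one.indicator (measurable_rowTrace i hD)) (fun B hB => ?_) hH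
  have hφ : Function.Injective fun r => if r = 2 * i + 1 then r else 2 * r := by
    intro a b; grind
  have hψ : Function.Injective fun c => if c % 4 = 0 then c else 4 * c + 2 := by
    intro a b; grind
  refine setLIntegral_condDistrib_of_measurePreserving (entriesOn_le _) (hP _ _ hφ hψ)
    (measurable_rowTrace i) (measurable_corner_entriesOn fun p => ?_)
    (measurable_into_entriesOn fun p hp => ?_) (fun x => ?_) hD hB
  · simp only [Set.mem_ofPred_eq]; omega
  · have hp' : p.1 ≠ 2 * i + 1 := hp
    convert (measurable_pi_apply (p.1, (if p.2 % 4 = 0 then p.2 else 4 * p.2 + 2) / 2)).comp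
      (comap_measurable corner) using 2 with x
    simp only [reindex, corner, Function.comp, if_neg hp']
    congr 2
    grind
  · ext l
    simp [rowTrace, reindex]

lemma lintegral_colTrace_mul
    (hP : ∀ φ ψ : ℕ → ℕ, φ.Injective → ψ.Injective → MeasurePreserving (reindex φ ψ) P P)
    (j : ℕ) {D : Set (ℕ → Bool)} (hD : MeasurableSet D) {H : (ℕ × ℕ → Bool) → ℝ≥0∞}
    (hH : Measurable[entriesOn {p | p.2 ≠ 2 * j + 1}] H) :
    ∫⁻ x, (colTrace j ⁻¹' D).indicator 1 x * H x ∂P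
      = ∫⁻ x, condDistrib (colTrace 0) corner P (corner x) D * H x ∂P := by
  rw [← condDistrib_colTrace hP j]
  symm
  refine lintegral_mul_congr_of_setLIntegral_eq (entriesOn_le _)
    ((Kernel.measurable_coe _ hD).comp measurable_corner)
    (measurable_one.indicator (measurable_colTrace j hD)) (fun B hB => ?_) hH
  have hφ : Function.Injective fun r => if r % 4 = 0 then r else 4 * r + 2 := by
    intro a b; grind
  have hψ : Function.Injective fun c => if c = 2 * j + 1 then c else 2 * c := by
    intro a b; grind
  refine setLIntegral_condDistrib_of_measurePreserving (entriesOn_le _) (hP _ _ hφ hψ)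
    (measurable_colTrace j) (measurable_corner_entriesOn fun p => ?_)
    (measurable_into_entriesOn fun p hp => ?_) (fun x => ?_) hD hB
  · simp only [Set.mem_ofPred_eq]; omega
  · have hp' : p.2 ≠ 2 * j + 1 := hp
    convert (measurable_pi_apply ((if p.1 % 4 = 0 then p.1 else 4 * p.1 + 2) / 2, p.2)).comp
      (comap_measurable corner) using 2 with x
    simp only [reindex, corner, Function.comp, if_neg hp']
    congr 2
    grind
  · ext k
    simp [colTrace, reindex]

lemma lintegral_oddEntry_mul
    (hP : ∀ φ ψ : ℕ → ℕ, φ.Injective → ψ.Injective → MeasurePreserving (reindex φ ψ) P P)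
    (i j : ℕ) {D : Set Bool} (hD : MeasurableSet D) {H : (ℕ × ℕ → Bool) → ℝ≥0∞}
    (hH : Measurable[entriesOn {p | p ≠ (2 * i + 1, 2 * j + 1)}] H) :
    ∫⁻ x, (oddEntry i j ⁻¹' D).indicator 1 x * H x ∂P
      = ∫⁻ x, condDistrib (oddEntry 0 0) (entryTrace 0 0) P (entryTrace i j x) D * H x ∂P := by
  rw [← condDistrib_oddEntry hP i j]
  symm
  refine lintegral_mul_congr_of_setLIntegral_eq (entriesOn_le _)
    ((Kernel.measurable_coe _ hD).comp (measurable_entryTrace i j))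
    (measurable_one.indicator (measurable_oddEntry i j hD)) (fun B hB => ?_) hH
  have hφ : ∀ a, Function.Injective fun r => if r = 2 * a + 1 then r else 4 * r := by
    intro a b c; grind
  refine setLIntegral_condDistrib_of_measurePreserving (entriesOn_le _) (hP _ _ (hφ i) (hφ j))
    (measurable_oddEntry i j) (measurable_entryTrace_entriesOn fun k l h => ?_)
    (measurable_into_entriesOn fun p hp => ?_) (fun x => ?_) hD hB
  · simp only [Set.mem_ofPred_eq, ne_eq, Prod.mk.injEq]; omega
  · have hZ := comap_measurable (m := inferInstance) (entryTrace i j)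
    by_cases h1 : p.1 = 2 * i + 1
    · have h2 : p.2 ≠ 2 * j + 1 := fun h2 => hp (Prod.ext h1 h2)
      convert (measurable_pi_apply p.2).comp
        ((measurable_fst.comp measurable_snd).comp hZ) using 2 with x
      simp [reindex, entryTrace, rowTrace, h1, h2]
    · by_cases h2 : p.2 = 2 * j + 1
      · convert (measurable_pi_apply p.1).comp
          ((measurable_snd.comp measurable_snd).comp hZ) using 2 with x
        simp [reindex, entryTrace, colTrace, h1, h2]
      · convert (measurable_pi_apply (2 * p.1, 2 * p.2)).comp
          (measurable_fst.comp hZ) using 2 with x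
        simp only [reindex, entryTrace, corner, Function.comp, if_neg h1, if_neg h2]
        congr 2 <;> omega
  · simp [oddEntry, reindex]

/-- Conditionally on the corner, the traces of distinct odd rows and columns are independent. -/
lemma map_traces_eq
    (hP : ∀ φ ψ : ℕ → ℕ, φ.Injective → ψ.Injective → MeasurePreserving (reindex φ ψ) P P)
    {F G : (ℕ × ℕ → Bool) → ℝ → ℕ → Bool} (hF : Measurable (Function.uncurry F))
    (hG : Measurable (Function.uncurry G))
    (hFκ : ∀ θ, unif.map (F θ) = condDistrib (rowTrace 0) corner P θ)
    (hGκ : ∀ θ, unif.map (G θ) = condDistrib (colTrace 0) corner P θ) (n : ℕ) :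
    P.map (fun x => (corner x, (fun i : Fin n => rowTrace i x), fun j : Fin n => colTrace j x))
      = ((P.map corner).prod ((Measure.pi fun _ : Fin n => unif).prod
          (Measure.pi fun _ : Fin n => unif))).map
        (fun q => (q.1, (fun i => F q.1 (q.2.1 i)), fun j => G q.1 (q.2.2 j))) := by
  have hm : Measurable (fun x : ℕ × ℕ → Bool =>
      (corner x, (fun i : Fin n => rowTrace i x), fun j : Fin n => colTrace j x)) := by fun_prop
  have hΦ := measurable_eval_prod_pi hF hG (ι := Fin n) (κ := Fin n)
  have := Measure.isProbabilityMeasure_map (μ := P) measurable_corner.aemeasurable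
  have := Measure.isProbabilityMeasure_map (μ := P) hm.aemeasurable
  have := Measure.isProbabilityMeasure_map (μ := (P.map corner).prod
    ((Measure.pi fun _ : Fin n => unif).prod (Measure.pi fun _ : Fin n => unif))) hΦ.aemeasurable
  refine measure_ext_prod_pi fun A B C hA hB hC => ?_
  have hbox := hA.prod ((MeasurableSet.univ_pi hB).prod (MeasurableSet.univ_pi hC))
  rw [Measure.map_apply hm hbox, Measure.map_apply hΦ hbox, Measure.prod_apply (hΦ hbox),
    lintegral_map (measurable_measure_prodMk_left (hΦ hbox)) measurable_corner]
  let f : Fin n ⊕ Fin n → (ℕ × ℕ → Bool) → ℝ≥0∞ := Sum.elim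
    (fun i => (rowTrace i ⁻¹' B i).indicator 1) (fun j => (colTrace j ⁻¹' C j).indicator 1)
  let g : Fin n ⊕ Fin n → (ℕ × ℕ → Bool) → ℝ≥0∞ := Sum.elim
    (fun i x => condDistrib (rowTrace 0) corner P (corner x) (B i))
    (fun j x => condDistrib (colTrace 0) corner P (corner x) (C j))
  let m : Fin n ⊕ Fin n → MeasurableSpace (ℕ × ℕ → Bool) := Sum.elim
    (fun i => entriesOn {p | p.1 ≠ 2 * i + 1}) (fun j => entriesOn {p | p.2 ≠ 2 * j + 1})
  have hcm : ∀ a, Measurable[m a] corner := by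
    rintro (i | j) <;> refine measurable_corner_entriesOn fun p => ?_ <;>
      simp only [Set.mem_ofPred_eq] <;> omega
  have key := lintegral_prod_mul_congr (P := P) m (f := f) (g := g) (H := (corner ⁻¹' A).indicator 1)
    ?_ ?_ ?_ ?_
  · calc _ = ∫⁻ x, (∏ a, f a x) * (corner ⁻¹' A).indicator 1 x ∂P := by
          rw [← lintegral_indicator_one (hm hbox)]
          congr with x
          by_cases hx : corner x ∈ A
          · by_cases h : (∀ i : Fin n, rowTrace i x ∈ B i) ∧ ∀ j : Fin n, colTrace j x ∈ C j
            · simp [Set.indicator, hx, h, f]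
            · rw [not_and_or] at h
              have : ∏ a, f a x = 0 := by
                rcases h with h | h <;> push Not at h <;> obtain ⟨i, hi⟩ := h
                · exact Finset.prod_eq_zero (Finset.mem_univ (Sum.inl i)) (by simp [f, hi])
                · exact Finset.prod_eq_zero (Finset.mem_univ (Sum.inr i)) (by simp [f, hi])
              rw [this, zero_mul, Set.indicator_of_notMem]
              simp only [Set.mem_preimage, Set.mem_prod, Set.mem_univ_pi]
              tauto
          · simp [hx]
      _ = ∫⁻ x, (∏ a, g a x) * (corner ⁻¹' A).indicator 1 x ∂P := key
      _ = _ := by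
          congr with x
          by_cases hx : corner x ∈ A
          · have hFx : Measurable (F (corner x)) := hF.of_uncurry_left
            have hGx : Measurable (G (corner x)) := hG.of_uncurry_left
            have : Prod.mk (corner x) ⁻¹' ((fun q : (ℕ × ℕ → Bool) × (Fin n → ℝ) × (Fin n → ℝ) =>
                (q.1, (fun i => F q.1 (q.2.1 i)), fun j => G q.1 (q.2.2 j))) ⁻¹'
                  (A ×ˢ Set.univ.pi B ×ˢ Set.univ.pi C))
                = (Set.univ.pi fun i => F (corner x) ⁻¹' B i) ×ˢ
                  (Set.univ.pi fun j => G (corner x) ⁻¹' C j) := by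
              ext q; simp [hx, Set.mem_pi]
            rw [this, Measure.prod_prod, Measure.pi_pi, Measure.pi_pi]
            simp [g, hx, ← hFκ, ← hGκ, Measure.map_apply hFx (hB _), Measure.map_apply hGx (hC _)]
          · have : Prod.mk (corner x) ⁻¹' ((fun q : (ℕ × ℕ → Bool) × (Fin n → ℝ) × (Fin n → ℝ) =>
                (q.1, (fun i => F q.1 (q.2.1 i)), fun j => G q.1 (q.2.2 j))) ⁻¹'
                  (A ×ˢ Set.univ.pi B ×ˢ Set.univ.pi C)) = ∅ := by
              ext q; simp [hx]
            simp [this, hx]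
  · rintro a (i | j) ha
    · refine measurable_indicator_one_preimage (?_ : Measurable[m a] (rowTrace i)) (hB i)
      rcases a with a | a
      · have : (a : ℕ) ≠ i := fun h => ha (congrArg Sum.inl (Fin.ext h))
        exact measurable_rowTrace_entriesOn fun l => by simp; omega
      · exact measurable_rowTrace_entriesOn fun l => by simp; omega
    · refine measurable_indicator_one_preimage (?_ : Measurable[m a] (colTrace j)) (hC j)
      rcases a with a | a
      · exact measurable_colTrace_entriesOn fun l => by simp; omega
      · have : (a : ℕ) ≠ j := fun h => ha (congrArg Sum.inr (Fin.ext h))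
        exact measurable_colTrace_entriesOn fun l => by simp; omega
  · rintro a (i | j) -
    · exact (Kernel.measurable_coe _ (hB i)).comp (hcm a)
    · exact (Kernel.measurable_coe _ (hC j)).comp (hcm a)
  · rintro (i | j) H hH
    · exact lintegral_rowTrace_mul hP i (hB i) hH
    · exact lintegral_colTrace_mul hP j (hC j) hH
  · exact fun a => measurable_indicator_one_preimage (hcm a) hA

end Array
/-- **Aldous–Hoover representation theorem for separately exchangeable binary arrays.**
If `[X_{i,j}]` is an infinite separately exchangeable binary array, then there is a probability
distribution `π` on (a measurable parametrization `Θ` of) graphons `W : [0,1]² → [0,1]` such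
that the law of `X` is the `π`-mixture of the laws `P_W`: on every finite-dimensional cylinder
set, the probability is obtained by assigning i.i.d. Uniform(0,1) latent features `U_i` to the
rows and `V_j` to the columns and setting `X_{i,j} = 1` with probability `W(U_i, V_j)`,
independently across entries given the features and `W`. -/
theorem statement16
    {Ω : Type*} [MeasurableSpace Ω]
    (μ : Measure Ω) [IsProbabilityMeasure μ]
    (X : ℕ → ℕ → Ω → Bool) (hX : ∀ i j, Measurable (X i j))
    (hse : SeparatelyExchangeable μ X) :
    ∃ (Θ : Type) (_ : MeasurableSpace Θ) (π : Measure Θ) (W : Θ → ℝ → ℝ → ℝ),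
      IsProbabilityMeasure π ∧
      Measurable (fun q : Θ × ℝ × ℝ => W q.1 q.2.1 q.2.2) ∧
      (∀ θ x y, W θ x y ∈ Set.Icc (0 : ℝ) 1) ∧
      ∀ (n : ℕ) (b : Fin n → Fin n → Bool),
        μ {ω | ∀ i j : Fin n, X i j ω = b i j}
          = ∫⁻ θ, ∫⁻ u, ∫⁻ v,
              ∏ i : Fin n, ∏ j : Fin n,
                ENNReal.ofReal (if b i j then W θ (u i) (v j) else 1 - W θ (u i) (v j))
              ∂(Measure.pi fun _ : Fin n => unif) ∂(Measure.pi fun _ : Fin n => unif) ∂π := by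
  
  have hm : Measurable fun ω (p : ℕ × ℕ) => X p.1 p.2 ω := by fun_prop
  have hP := fun φ ψ (hφ : Function.Injective φ) (hψ : Function.Injective ψ) =>
    hse.measurePreserving_reindex hX hφ hψ
  have := Measure.isProbabilityMeasure_map (μ := μ) hm.aemeasurable
  set P := μ.map fun ω (p : ℕ × ℕ) => X p.1 p.2 ω with hPdef
  obtain ⟨F, hF, hFκ⟩ := exists_measurable_map_unif_eq (condDistrib (rowTrace 0) corner P)
  obtain ⟨G, hG, hGκ⟩ := exists_measurable_map_unif_eq (condDistrib (colTrace 0) corner P)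
  let K := condDistrib (oddEntry 0 0) (entryTrace 0 0) P
  refine ⟨ℕ × ℕ → Bool, inferInstance, P.map corner,
    fun θ u v => (K (θ, F θ u, G θ v)).real {true},
    Measure.isProbabilityMeasure_map measurable_corner.aemeasurable, ?_,
    fun θ x y => ⟨measureReal_nonneg, measureReal_le_one⟩, fun n b => ?_⟩
  · have h1 : Measurable fun q : (ℕ × ℕ → Bool) × ℝ × ℝ => F q.1 q.2.1 :=
      hF.comp (by fun_prop : Measurable fun q : (ℕ × ℕ → Bool) × ℝ × ℝ => (q.1, q.2.1))
    have h2 : Measurable fun q : (ℕ × ℕ → Bool) × ℝ × ℝ => G q.1 q.2.2 :=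
      hG.comp (by fun_prop : Measurable fun q : (ℕ × ℕ → Bool) × ℝ × ℝ => (q.1, q.2.2))
    exact ((K.measurable_coe (measurableSet_singleton true)).comp
      (measurable_fst.prodMk (h1.prodMk h2))).ennreal_toReal
  have hK : ∀ z (c : Bool), ENNReal.ofReal
      (if c then (K z).real {true} else 1 - (K z).real {true}) = K z {c} := by
    rintro z (_ | _)
    · have h : ({false} : Set Bool) = {true}ᶜ := by ext x; cases x <;> simp
      rw [h, ← probReal_compl_eq_one_sub (measurableSet_singleton _)]
      simp
    · simp
  simp_rw [hK]
  let Q : (ℕ × ℕ → Bool) × (Fin n → ℕ → Bool) × (Fin n → ℕ → Bool) → ℝ≥0∞ := fun z =>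
    ∏ i : Fin n, ∏ j : Fin n, K (z.1, z.2.1 i, z.2.2 j) {b i j}
  have hQ : Measurable Q := Finset.measurable_prod _ fun i _ => Finset.measurable_prod _ fun j _ =>
    (K.measurable_coe (measurableSet_singleton _)).comp (by fun_prop)
  have hΦ := measurable_eval_prod_pi hF hG (ι := Fin n) (κ := Fin n)
  have hQΦ : Measurable fun q : (ℕ × ℕ → Bool) × (Fin n → ℝ) × (Fin n → ℝ) =>
      Q (q.1, (fun i => F q.1 (q.2.1 i)), fun j => G q.1 (q.2.2 j)) := hQ.comp hΦ
  have hS : MeasurableSet {x : ℕ × ℕ → Bool | ∀ i j : Fin n, x (i, j) = b i j} := by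
    simp only [Set.ofPred_forall]
    exact .iInter fun i => .iInter fun j =>
      measurableSet_eq_fun (measurable_pi_apply _) measurable_const
  have hodd : Function.Injective fun k : ℕ => 2 * k + 1 := by intro a c; grind
  calc μ {ω | ∀ i j : Fin n, X i j ω = b i j}
      = P {x | ∀ i j : Fin n, x (i, j) = b i j} := by rw [hPdef, Measure.map_apply hm hS]; rfl
    _ = P {x | ∀ i j : Fin n, oddEntry i j x = b i j} :=
        ((hP _ _ hodd hodd).measure_preimage hS.nullMeasurableSet).symm
    _ = ∫⁻ x, (∏ p : Fin n × Fin n, (oddEntry p.1 p.2 ⁻¹' {b p.1 p.2}).indicator 1 x) * 1 ∂P := by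
        have hS' : MeasurableSet {x : ℕ × ℕ → Bool | ∀ i j : Fin n, oddEntry i j x = b i j} :=
          (hP _ _ hodd hodd).measurable hS
        rw [← lintegral_indicator_one hS']
        congr with x
        by_cases h : ∀ i j : Fin n, oddEntry i j x = b i j
        · simp [Set.indicator, h]
        · have h' := h
          push Not at h'
          obtain ⟨i, j, hij⟩ := h'
          rw [Finset.prod_eq_zero (Finset.mem_univ (i, j)) (by simp [hij]), zero_mul,
            Set.indicator_of_notMem (by exact h)]
    _ = ∫⁻ x, (∏ p : Fin n × Fin n, K (entryTrace p.1 p.2 x) {b p.1 p.2}) * 1 ∂P := by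
        refine lintegral_prod_mul_congr
          (fun p : Fin n × Fin n => entriesOn {q | q ≠ (2 * p.1.1 + 1, 2 * p.2.1 + 1)})
          (fun p q hpq => ?_) (fun p q _ => ?_) (fun p H hH => ?_) fun p => measurable_const
        · refine measurable_indicator_one_preimage (Y := oddEntry q.1 q.2)
            (measurable_entriesOn_apply ?_) (measurableSet_singleton _)
          simp only [Set.mem_ofPred_eq, ne_eq, Prod.mk.injEq]
          intro h
          exact hpq (Prod.ext (Fin.ext (by omega)) (Fin.ext (by omega)))
        · refine (K.measurable_coe (measurableSet_singleton _)).comp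
            (measurable_entryTrace_entriesOn fun k l h => ?_)
          simp only [Set.mem_ofPred_eq, ne_eq, Prod.mk.injEq]
          omega
        · exact lintegral_oddEntry_mul hP p.1 p.2 (measurableSet_singleton _) hH
    _ = ∫⁻ z, Q z ∂(P.map fun x =>
          (corner x, (fun i : Fin n => rowTrace i x), fun j : Fin n => colTrace j x)) := by
        rw [lintegral_map hQ (by fun_prop)]
        simp only [Q, mul_one, Fintype.prod_prod_type]
        rfl
    _ = _ := by
        rw [map_traces_eq hP hF hG hFκ hGκ, lintegral_map hQ hΦ, lintegral_prod _ hQΦ.aemeasurable]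
        refine lintegral_congr fun θ => ?_
        exact lintegral_prod _ (hQΦ.comp measurable_prodMk_left).aemeasurable
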